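/- For every h-normal Γ-linear connection of Cartan type, the following local Bianchi identities hold for all indices l, i, j, k, p: (17) A_{j,k}{ (P^l_p1(j))|_(k) + Pv^r_1j S^l_p(k)(r) } = −(S^l_p(j)(k))_/1, and (18) A_{j,k}{ P^l_pr(j) C^r_ik − S^l_p(j)(r) Pv^r_ik − (P^l_pi(k))|_(j) } = −(S^l_p(j)(k))_|i. -/

import Mathlib

open Finset

noncomputable section

namespace Jet

/-- Smooth real-valued functions of `(t, x, y) ∈ ℝ × ℝⁿ × ℝⁿ`, the local coordinates
of the 1-jet space `J¹(ℝ, M)`. -/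
abbrev Fn (n : ℕ) : Type := ℝ → (Fin n → ℝ) → (Fin n → ℝ) → ℝ

def Smooth {n : ℕ} (F : Fn n) : Prop :=
  ContDiff ℝ (⊤ : ℕ∞) (fun p : ℝ × (Fin n → ℝ) × (Fin n → ℝ) => F p.1 p.2.1 p.2.2)

/-- Partial derivative in the time variable `t`. -/
def pt {n : ℕ} (F : Fn n) : Fn n := fun t x y => deriv (fun s => F s x y) t

/-- Partial derivative in the spatial variable `xⁱ`. -/
def px {n : ℕ} (i : Fin n) (F : Fn n) : Fn n :=
  fun t x y => deriv (fun s => F t (Function.update x i s) y) (x i)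

/-- Partial derivative in the fibre variable `yⁱ`. -/
def py {n : ℕ} (i : Fin n) (F : Fn n) : Fn n :=
  fun t x y => deriv (fun s => F t x (Function.update y i s)) (y i)

/-- Kronecker delta, as a constant function on the jet space. -/
def kron {n : ℕ} (i j : Fin n) : Fn n := if i = j then 1 else 0

/-- The coordinate function `yⁱ`. -/
def yc {n : ℕ} (i : Fin n) : Fn n := fun _ _ y => y i

/-- The Christoffel symbol `κ(t) = (1/(2h)) dh/dt` of a Riemannian metric `h` on `ℝ`,
as a function on the jet space. -/
def chr {n : ℕ} (h : ℝ → ℝ) : Fn n := fun t _ _ => deriv h t / (2 * h t)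

/-- The metric `h(t)` as a function on the jet space. -/
def hfun {n : ℕ} (h : ℝ → ℝ) : Fn n := fun t _ _ => h t

/-- The derivative `dh/dt` as a function on the jet space. -/
def hder {n : ℕ} (h : ℝ → ℝ) : Fn n := fun t _ _ => deriv h t

variable {n : ℕ}

/-- The adapted temporal derivative `δ/δt = ∂/∂t − Mʳ ∂/∂yʳ` determined by a
nonlinear connection `(M, N)`. -/
def dt (M : Fin n → Fn n) (F : Fn n) : Fn n := pt F - ∑ r, M r * py r F

/-- The adapted spatial derivative `δ/δxᵏ = ∂/∂xᵏ − Nʳₖ ∂/∂yʳ`. -/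
def dx (N : Fin n → Fin n → Fn n) (k : Fin n) (F : Fn n) : Fn n :=
  px k F - ∑ r, N r k * py r F

/-- An `h`-normal `Γ`-linear connection `(κ, Gᵏᵢ, Lᵏᵢⱼ, Cᵏᵢⱼ)`. -/
structure Conn (n : ℕ) where
  κ : Fn n
  G : Fin n → Fin n → Fn n
  L : Fin n → Fin n → Fin n → Fn n
  C : Fin n → Fin n → Fin n → Fn n

/-! ### Torsion d-tensors -/

/-- `Tʳ₁ⱼ = −Gʳⱼ`. -/
def T1 (Γ : Conn n) (r j : Fin n) : Fn n := -Γ.G r j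

/-- `Rvʳ₁ⱼ = (δ/δxʲ)Mʳ − (δ/δt)Nʳⱼ`. -/
def Rv1 (M : Fin n → Fn n) (N : Fin n → Fin n → Fn n) (r j : Fin n) : Fn n :=
  dx N j (M r) - dt M (N r j)

/-- `Tʳᵢⱼ = Lʳᵢⱼ − Lʳⱼᵢ`. -/
def Tsp (Γ : Conn n) (r i j : Fin n) : Fn n := Γ.L r i j - Γ.L r j i

/-- `Rvʳᵢⱼ = (δ/δxʲ)Nʳᵢ − (δ/δxⁱ)Nʳⱼ`. -/
def Rvsp (M : Fin n → Fn n) (N : Fin n → Fin n → Fn n) (r i j : Fin n) : Fn n :=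
  dx N j (N r i) - dx N i (N r j)

/-- `Pvʳ₁ⱼ = ∂Mʳ/∂yʲ − Gʳⱼ + δʳⱼ κ`. -/
def Pv1 (M : Fin n → Fn n) (Γ : Conn n) (r j : Fin n) : Fn n :=
  py j (M r) - Γ.G r j + kron r j * Γ.κ

/-- `Phʳᵢⱼ = Cʳᵢⱼ`. -/
def Phsp (Γ : Conn n) (r i j : Fin n) : Fn n := Γ.C r i j

/-- `Pvʳᵢⱼ = ∂Nʳᵢ/∂yʲ − Lʳⱼᵢ`. -/
def Pvsp (N : Fin n → Fin n → Fn n) (Γ : Conn n) (r i j : Fin n) : Fn n :=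
  py j (N r i) - Γ.L r j i

/-- `Sʳᵢⱼ = Cʳᵢⱼ − Cʳⱼᵢ`. -/
def Ssp (Γ : Conn n) (r i j : Fin n) : Fn n := Γ.C r i j - Γ.C r j i

/-! ### Generic covariant derivatives of d-tensors -/

/-- Index types of the (valued) indices of a d-tensor: upper/lower spatial,
upper/lower vertical.  (Temporal indices carry no value; they are accounted for by the
temporal weight `p` = number of upper temporal indices minus number of lower temporal
indices.) -/
inductive IdxType | uS | lS | uV | lV

/-- A d-tensor component family with `m` valued indices. -/
abbrev Tensor (n m : ℕ) := (Fin m → Fin n) → Fn n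

/-- The `ℝ`-horizontal covariant derivative `D_{/1}` of a d-tensor `D` with valued index
signature `σ` and temporal weight `p`. -/
def covT {m : ℕ} (M : Fin n → Fn n) (Γ : Conn n) (p : ℤ) (σ : Fin m → IdxType)
    (D : Tensor n m) : Tensor n m := fun a =>
  dt M (D a) + p • (Γ.κ * D a)
    + ∑ q : Fin m,
      (match σ q with
      | .uS => ∑ r, D (Function.update a q r) * Γ.G (a q) r
      | .lS => -∑ r, D (Function.update a q r) * Γ.G r (a q)
      | .uV => ∑ r, D (Function.update a q r) * (Γ.G (a q) r - kron (a q) r * Γ.κ)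
      | .lV => -∑ r, D (Function.update a q r) * (Γ.G r (a q) - kron r (a q) * Γ.κ) : Fn n)

/-- The `M`-horizontal covariant derivative `D_{|k}`. -/
def covX {m : ℕ} (N : Fin n → Fin n → Fn n) (Γ : Conn n) (σ : Fin m → IdxType)
    (k : Fin n) (D : Tensor n m) : Tensor n m := fun a =>
  dx N k (D a)
    + ∑ q : Fin m,
      (match σ q with
      | .uS => ∑ r, D (Function.update a q r) * Γ.L (a q) r k
      | .uV => ∑ r, D (Function.update a q r) * Γ.L (a q) r k
      | .lS => -∑ r, D (Function.update a q r) * Γ.L r (a q) k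
      | .lV => -∑ r, D (Function.update a q r) * Γ.L r (a q) k : Fn n)

/-- The vertical covariant derivative `D|_{(k)}`. -/
def covY {m : ℕ} (Γ : Conn n) (σ : Fin m → IdxType)
    (k : Fin n) (D : Tensor n m) : Tensor n m := fun a =>
  py k (D a)
    + ∑ q : Fin m,
      (match σ q with
      | .uS => ∑ r, D (Function.update a q r) * Γ.C (a q) r k
      | .uV => ∑ r, D (Function.update a q r) * Γ.C (a q) r k
      | .lS => -∑ r, D (Function.update a q r) * Γ.C r (a q) k
      | .lV => -∑ r, D (Function.update a q r) * Γ.C r (a q) k : Fn n)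

/-- The coefficients `Cᵏᵢⱼ` viewed as a d-tensor with signature
(upper spatial, lower spatial, lower vertical). -/
def CT (Γ : Conn n) : Tensor n 3 := fun a => Γ.C (a 0) (a 1) (a 2)

/-- The signature of `Cᵏᵢⱼ`. -/
def sigC : Fin 3 → IdxType := ![IdxType.uS, IdxType.lS, IdxType.lV]

/-! ### Curvature d-tensors -/

/-- `Rˡᵢ₁ₖ`. -/
def Rc1 (M : Fin n → Fn n) (N : Fin n → Fin n → Fn n) (Γ : Conn n) (l i k : Fin n) : Fn n :=
  dx N k (Γ.G l i) - dt M (Γ.L l i k) + ∑ r, Γ.G r i * Γ.L l r k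
    - ∑ r, Γ.L r i k * Γ.G l r + ∑ r, Γ.C l i r * Rv1 M N r k

/-- `Rˡᵢⱼₖ`. -/
def Rc (M : Fin n → Fn n) (N : Fin n → Fin n → Fn n) (Γ : Conn n) (l i j k : Fin n) : Fn n :=
  dx N k (Γ.L l i j) - dx N j (Γ.L l i k) + ∑ r, Γ.L r i j * Γ.L l r k
    - ∑ r, Γ.L r i k * Γ.L l r j + ∑ r, Γ.C l i r * Rvsp M N r j k

/-- `Pˡᵢ₁₍ₖ₎`. -/
def Pc1 (M : Fin n → Fn n) (N : Fin n → Fin n → Fn n) (Γ : Conn n) (l i k : Fin n) : Fn n :=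
  py k (Γ.G l i) - covT M Γ 0 sigC (CT Γ) ![l, i, k] + ∑ r, Γ.C l i r * Pv1 M Γ r k

/-- `Pˡᵢⱼ₍ₖ₎`. -/
def Pc (M : Fin n → Fn n) (N : Fin n → Fin n → Fn n) (Γ : Conn n) (l i j k : Fin n) : Fn n :=
  py k (Γ.L l i j) - covX N Γ sigC j (CT Γ) ![l, i, k] + ∑ r, Γ.C l i r * Pvsp N Γ r j k

/-- `Sˡᵢ₍ⱼ₎₍ₖ₎`. -/
def Sc (Γ : Conn n) (l i j k : Fin n) : Fn n :=
  py k (Γ.C l i j) - py j (Γ.C l i k)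
    + ∑ r, Γ.C r i j * Γ.C l r k - ∑ r, Γ.C r i k * Γ.C l r j

end Jet

namespace Jet

variable {n : ℕ}

/-- A family with one valued index, viewed as a d-tensor. -/
def famT (X : Fin n → Fn n) : Tensor n 1 := fun a => X (a 0)

def T1T (Γ : Conn n) : Tensor n 2 := fun a => T1 Γ (a 0) (a 1)
def Rv1T (M : Fin n → Fn n) (N : Fin n → Fin n → Fn n) : Tensor n 2 :=
  fun a => Rv1 M N (a 0) (a 1)
def RvspT (M : Fin n → Fn n) (N : Fin n → Fin n → Fn n) : Tensor n 3 :=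
  fun a => Rvsp M N (a 0) (a 1) (a 2)
def Pv1T (M : Fin n → Fn n) (Γ : Conn n) : Tensor n 2 := fun a => Pv1 M Γ (a 0) (a 1)
def PvspT (N : Fin n → Fin n → Fn n) (Γ : Conn n) : Tensor n 3 :=
  fun a => Pvsp N Γ (a 0) (a 1) (a 2)
def Rc1T (M : Fin n → Fn n) (N : Fin n → Fin n → Fn n) (Γ : Conn n) : Tensor n 3 :=
  fun a => Rc1 M N Γ (a 0) (a 1) (a 2)
def RcT (M : Fin n → Fn n) (N : Fin n → Fin n → Fn n) (Γ : Conn n) : Tensor n 4 :=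
  fun a => Rc M N Γ (a 0) (a 1) (a 2) (a 3)
def Pc1T (M : Fin n → Fn n) (N : Fin n → Fin n → Fn n) (Γ : Conn n) : Tensor n 3 :=
  fun a => Pc1 M N Γ (a 0) (a 1) (a 2)
def PcT (M : Fin n → Fn n) (N : Fin n → Fin n → Fn n) (Γ : Conn n) : Tensor n 4 :=
  fun a => Pc M N Γ (a 0) (a 1) (a 2) (a 3)
def ScT (Γ : Conn n) : Tensor n 4 := fun a => Sc Γ (a 0) (a 1) (a 2) (a 3)

/-- valued-index signatures (temporal indices are tracked by the weight `p` only) -/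
def sig0 : Fin 0 → IdxType := ![]
def siglS : Fin 1 → IdxType := ![IdxType.lS]
def siglV : Fin 1 → IdxType := ![IdxType.lV]
def sigU : Fin 1 → IdxType := ![IdxType.uS]
def sigV : Fin 1 → IdxType := ![IdxType.uV]
def sigUlS : Fin 2 → IdxType := ![IdxType.uS, IdxType.lS]
def sigUlV : Fin 2 → IdxType := ![IdxType.uS, IdxType.lV]
def sigVlS : Fin 2 → IdxType := ![IdxType.uV, IdxType.lS]
def sigVlV : Fin 2 → IdxType := ![IdxType.uV, IdxType.lV]
def sigRvsp : Fin 3 → IdxType := ![IdxType.uV, IdxType.lS, IdxType.lS]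
def sigPvsp : Fin 3 → IdxType := ![IdxType.uV, IdxType.lS, IdxType.lV]
def sigRc1 : Fin 3 → IdxType := ![IdxType.uS, IdxType.lS, IdxType.lS]
def sigRc : Fin 4 → IdxType := ![IdxType.uS, IdxType.lS, IdxType.lS, IdxType.lS]
def sigPc1 : Fin 3 → IdxType := ![IdxType.uS, IdxType.lS, IdxType.lV]
def sigPc : Fin 4 → IdxType := ![IdxType.uS, IdxType.lS, IdxType.lS, IdxType.lV]
def sigSc : Fin 4 → IdxType := ![IdxType.uS, IdxType.lS, IdxType.lV, IdxType.lV]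

end Jet

namespace Jet

variable {n : ℕ}

/-- The jet-space function `F` as a function of one variable in a normed space. -/
def unc (F : Fn n) : ℝ × (Fin n → ℝ) × (Fin n → ℝ) → ℝ := fun p => F p.1 p.2.1 p.2.2

/-- The derivative of `F` in the constant direction `v`. -/
def dir (v : ℝ × (Fin n → ℝ) × (Fin n → ℝ)) (F : Fn n) : Fn n :=
  fun t x y => fderiv ℝ (unc F) (t, x, y) v

lemma Smooth.contDiff {F : Fn n} (hF : Smooth F) : ContDiff ℝ (⊤ : ℕ∞) (unc F) := hF

lemma Smooth.differentiable {F : Fn n} (hF : Smooth F) : Differentiable ℝ (unc F) :=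
  hF.contDiff.differentiable (by simp)

lemma Smooth.add {F H : Fn n} (hF : Smooth F) (hH : Smooth H) : Smooth (F + H) :=
  ContDiff.add hF.contDiff hH.contDiff

lemma Smooth.sub {F H : Fn n} (hF : Smooth F) (hH : Smooth H) : Smooth (F - H) :=
  ContDiff.sub hF.contDiff hH.contDiff

lemma Smooth.mul {F H : Fn n} (hF : Smooth F) (hH : Smooth H) : Smooth (F * H) :=
  ContDiff.mul hF.contDiff hH.contDiff

lemma Smooth.zero : Smooth (0 : Fn n) := contDiff_const (c := (0 : ℝ))

lemma Smooth.sum {ι : Type*} {s : Finset ι} {F : ι → Fn n} (hF : ∀ r, Smooth (F r)) :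
    Smooth (∑ r ∈ s, F r) :=
  Finset.sum_induction F Smooth (fun _ _ => Smooth.add) Smooth.zero fun r _ => hF r

/-- Operators that act as derivations on the smooth functions. -/
structure IsDer (d : Fn n → Fn n) : Prop where
  smooth : ∀ {F}, Smooth F → Smooth (d F)
  add : ∀ {F H}, Smooth F → Smooth H → d (F + H) = d F + d H
  sub : ∀ {F H}, Smooth F → Smooth H → d (F - H) = d F - d H
  mul : ∀ {F H}, Smooth F → Smooth H → d (F * H) = d F * H + F * d H

lemma IsDer.zero {d : Fn n → Fn n} (hd : IsDer d) : d 0 = 0 := by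
  simpa using hd.sub Smooth.zero Smooth.zero

lemma IsDer.sum {d : Fn n → Fn n} (hd : IsDer d) {ι : Type*} {s : Finset ι} {F : ι → Fn n}
    (hF : ∀ r, Smooth (F r)) : d (∑ r ∈ s, F r) = ∑ r ∈ s, d (F r) := by
  classical
  induction s using Finset.induction_on with
  | empty => simpa using hd.zero
  | insert a s ha ih => rw [sum_insert ha, sum_insert ha, hd.add (hF a) (Smooth.sum hF), ih]

lemma isDer_dir (v : ℝ × (Fin n → ℝ) × (Fin n → ℝ)) : IsDer (dir (n := n) v) where
  smooth {F} hF := by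
    have h1 : ContDiff ℝ (⊤ : ℕ∞) (fderiv ℝ (unc F)) := hF.contDiff.fderiv_right (by simp)
    exact h1.clm_apply contDiff_const
  add {F H} hF hH := by
    funext t x y
    have h1 : unc (F + H) = unc F + unc H := rfl
    simp [dir, h1, fderiv_add (hF.differentiable _) (hH.differentiable _)]
  sub {F H} hF hH := by
    funext t x y
    have h1 : unc (F - H) = unc F - unc H := rfl
    simp [dir, h1, fderiv_sub (hF.differentiable _) (hH.differentiable _)]
  mul {F H} hF hH := by
    funext t x y
    have h1 : unc (F * H) = unc F * unc H := rfl
    simp only [dir, h1, fderiv_mul (hF.differentiable _) (hH.differentiable _)]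
    simp [unc, dir]
    ring

lemma dir_comm (v w : ℝ × (Fin n → ℝ) × (Fin n → ℝ)) {F : Fn n} (hF : Smooth F) :
    dir v (dir w F) = dir w (dir v F) := by
  funext t x y
  have h1 : ContDiff ℝ (⊤ : ℕ∞) (fderiv ℝ (unc F)) := hF.contDiff.fderiv_right (by simp)
  have h2 : Differentiable ℝ (fderiv ℝ (unc F)) := h1.differentiable (by simp)
  have key (v w : ℝ × (Fin n → ℝ) × (Fin n → ℝ)) :
      dir v (dir w F) t x y = fderiv ℝ (fderiv ℝ (unc F)) (t, x, y) v w := by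
    have h3 : unc (dir w F) = fun p => fderiv ℝ (unc F) p w := rfl
    simp only [dir, h3]
    rw [fderiv_clm_apply (h2 _) (differentiableAt_const _)]
    simp
  rw [key, key]
  have h4 : minSmoothness ℝ 2 ≤ ((⊤ : ℕ∞) : WithTop ℕ∞) := by
    rw [minSmoothness_of_isRCLikeNormedField]
    exact WithTop.coe_le_coe.2 (le_top : (2 : ℕ∞) ≤ ⊤)
  exact (hF.contDiff.contDiffAt.isSymmSndFDerivAt h4) v w

lemma pt_eq_dir {F : Fn n} (hF : Smooth F) : pt F = dir (1, 0, 0) F := by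
  funext t x y
  have h1 : HasDerivAt (fun s : ℝ => (s, x, y)) (1, 0, 0) t :=
    (hasDerivAt_id t).prodMk (hasDerivAt_const t (x, y))
  exact ((hF.differentiable (t, x, y)).hasFDerivAt.comp_hasDerivAt t h1).deriv

lemma px_eq_dir (i : Fin n) {F : Fn n} (hF : Smooth F) :
    px i F = dir (0, Pi.single i 1, 0) F := by
  funext t x y
  have h1 : HasDerivAt (fun s : ℝ => (t, Function.update x i s, y)) (0, Pi.single i 1, 0) (x i) :=
    (hasDerivAt_const _ t).prodMk ((hasDerivAt_update x i (x i)).prodMk (hasDerivAt_const _ y))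
  have h2 := (hF.differentiable (t, Function.update x i (x i), y)).hasFDerivAt.comp_hasDerivAt
    (x i) h1
  rw [Function.update_eq_self] at h2
  exact h2.deriv

lemma py_eq_dir (i : Fin n) {F : Fn n} (hF : Smooth F) :
    py i F = dir (0, 0, Pi.single i 1) F := by
  funext t x y
  have h1 : HasDerivAt (fun s : ℝ => (t, x, Function.update y i s)) (0, 0, Pi.single i 1) (y i) :=
    (hasDerivAt_const _ t).prodMk ((hasDerivAt_const _ x).prodMk (hasDerivAt_update y i (y i)))
  have h2 := (hF.differentiable (t, x, Function.update y i (y i))).hasFDerivAt.comp_hasDerivAt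
    (y i) h1
  rw [Function.update_eq_self] at h2
  exact h2.deriv

lemma IsDer.congr {d e : Fn n → Fn n} (he : IsDer e) (h : ∀ {F}, Smooth F → d F = e F) :
    IsDer d where
  smooth hF := by rw [h hF]; exact he.smooth hF
  add hF hH := by rw [h (hF.add hH), h hF, h hH, he.add hF hH]
  sub hF hH := by rw [h (hF.sub hH), h hF, h hH, he.sub hF hH]
  mul hF hH := by rw [h (hF.mul hH), h hF, h hH, he.mul hF hH]

lemma isDer_pt : IsDer (pt (n := n)) := (isDer_dir _).congr pt_eq_dir

lemma isDer_px (i : Fin n) : IsDer (px i) := (isDer_dir _).congr (px_eq_dir i)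

lemma isDer_py (i : Fin n) : IsDer (py i) := (isDer_dir _).congr (py_eq_dir i)

lemma py_comm (j k : Fin n) {F : Fn n} (hF : Smooth F) : py k (py j F) = py j (py k F) := by
  rw [py_eq_dir k ((isDer_py j).smooth hF), py_eq_dir j ((isDer_py k).smooth hF),
    py_eq_dir j hF, py_eq_dir k hF, dir_comm _ _ hF]

lemma py_pt_comm (k : Fin n) {F : Fn n} (hF : Smooth F) : py k (pt F) = pt (py k F) := by
  rw [py_eq_dir k (isDer_pt.smooth hF), pt_eq_dir ((isDer_py k).smooth hF),
    py_eq_dir k hF, pt_eq_dir hF, dir_comm _ _ hF]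

lemma py_px_comm (k i : Fin n) {F : Fn n} (hF : Smooth F) : py k (px i F) = px i (py k F) := by
  rw [py_eq_dir k ((isDer_px i).smooth hF), px_eq_dir i ((isDer_py k).smooth hF),
    py_eq_dir k hF, px_eq_dir i hF, dir_comm _ _ hF]

/-- The horizontal operator `E − Aʳ ∂/∂yʳ`. -/
def adapted (E : Fn n → Fn n) (A : Fin n → Fn n) (F : Fn n) : Fn n := E F - ∑ r, A r * py r F

lemma isDer_adapted {E : Fn n → Fn n} (hE : IsDer E) {A : Fin n → Fn n}
    (hA : ∀ r, Smooth (A r)) : IsDer (adapted E A) where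
  smooth hF := (hE.smooth hF).sub (Smooth.sum fun r => (hA r).mul ((isDer_py r).smooth hF))
  add hF hH := by
    simp only [adapted, hE.add hF hH, (isDer_py _).add hF hH, mul_add, sum_add_distrib]
    ring
  sub hF hH := by
    simp only [adapted, hE.sub hF hH, (isDer_py _).sub hF hH, mul_sub, sum_sub_distrib]
    ring
  mul {F H} hF hH := by
    simp only [adapted, hE.mul hF hH, (isDer_py _).mul hF hH, mul_add, sum_add_distrib, sub_mul,
      mul_sub, sum_mul, mul_sum, mul_assoc, mul_left_comm F]
    ring

lemma py_adapted {E : Fn n → Fn n} (hE : IsDer E)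
    (hc : ∀ k F, Smooth F → py k (E F) = E (py k F)) {A : Fin n → Fn n}
    (hA : ∀ r, Smooth (A r)) (k : Fin n) {F : Fn n} (hF : Smooth F) :
    py k (adapted E A F) = adapted E A (py k F) - ∑ r, py k (A r) * py r F := by
  have hs (r) : Smooth (py r F) := (isDer_py r).smooth hF
  simp only [adapted]
  rw [(isDer_py k).sub (hE.smooth hF) (Smooth.sum fun r => (hA r).mul (hs r)),
    (isDer_py k).sum (fun r => (hA r).mul (hs r)), hc k F hF]
  simp only [(isDer_py k).mul (hA _) (hs _), sum_add_distrib, py_comm _ k hF]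
  ring

section Matrices

variable {X Y : Matrix (Fin n) (Fin n) (Fn n)} {d : Fn n → Fn n}

/-- Matrices with smooth entries. -/
def SmoothMat (X : Matrix (Fin n) (Fin n) (Fn n)) : Prop := ∀ i j, Smooth (X i j)

lemma SmoothMat.sub (hX : SmoothMat X) (hY : SmoothMat Y) : SmoothMat (X - Y) :=
  fun i j => (hX i j).sub (hY i j)

lemma SmoothMat.mul (hX : SmoothMat X) (hY : SmoothMat Y) : SmoothMat (X * Y) :=
  fun i j => by
    rw [Matrix.mul_apply]
    exact Smooth.sum fun r => (hX i r).mul (hY r j)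

lemma SmoothMat.smul {a : Fn n} (ha : Smooth a) (hX : SmoothMat X) : SmoothMat (a • X) :=
  fun i j => ha.mul (hX i j)

lemma SmoothMat.sum {Z : Fin n → Matrix (Fin n) (Fin n) (Fn n)} (hZ : ∀ r, SmoothMat (Z r)) :
    SmoothMat (∑ r, Z r) := fun i j => by
  rw [Matrix.sum_apply]
  exact Smooth.sum fun r => hZ r i j

lemma IsDer.smoothMat (hd : IsDer d) (hX : SmoothMat X) : SmoothMat (X.map d) :=
  fun i j => hd.smooth (hX i j)

lemma IsDer.map_add (hd : IsDer d) (hX : SmoothMat X) (hY : SmoothMat Y) :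
    (X + Y).map d = X.map d + Y.map d := by
  ext1 i j
  exact hd.add (hX i j) (hY i j)

lemma IsDer.map_sub (hd : IsDer d) (hX : SmoothMat X) (hY : SmoothMat Y) :
    (X - Y).map d = X.map d - Y.map d := by
  ext1 i j
  exact hd.sub (hX i j) (hY i j)

lemma IsDer.map_mul (hd : IsDer d) (hX : SmoothMat X) (hY : SmoothMat Y) :
    (X * Y).map d = X.map d * Y + X * Y.map d := by
  ext1 i j
  simp only [Matrix.map_apply, Matrix.mul_apply, Matrix.add_apply]
  rw [hd.sum fun r => (hX i r).mul (hY r j), ← sum_add_distrib]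
  exact sum_congr rfl fun r _ => hd.mul (hX i r) (hY r j)

lemma IsDer.map_smul (hd : IsDer d) {a : Fn n} (ha : Smooth a) (hX : SmoothMat X) :
    (a • X).map d = d a • X + a • X.map d := by
  ext1 i j
  exact hd.mul ha (hX i j)

lemma IsDer.map_sum (hd : IsDer d) {Z : Fin n → Matrix (Fin n) (Fin n) (Fn n)}
    (hZ : ∀ r, SmoothMat (Z r)) : (∑ r, Z r).map d = ∑ r, (Z r).map d := by
  ext1 i j
  simp only [Matrix.map_apply, Matrix.sum_apply]
  exact hd.sum fun r => hZ r i j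

end Matrices

/-- The mixed curvature of the operators `E − Aʳ ∂/∂yʳ + B` and `∂/∂yᵏ + Cₖ`. -/
def mixedCurv (E : Fn n → Fn n) (A : Fin n → Fn n) (B : Matrix (Fin n) (Fin n) (Fn n))
    (C : Fin n → Matrix (Fin n) (Fin n) (Fn n)) (k : Fin n) : Matrix (Fin n) (Fin n) (Fn n) :=
  B.map (py k) - (C k).map (adapted E A) - (B * C k - C k * B) + ∑ r, py k (A r) • C r

/-- The curvature of the operators `∂/∂yᵏ + Cₖ` and `∂/∂yʲ + Cⱼ`. -/
def vertCurv (C : Fin n → Matrix (Fin n) (Fin n) (Fn n)) (j k : Fin n) :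
    Matrix (Fin n) (Fin n) (Fn n) :=
  (C j).map (py k) - (C k).map (py j) + (C k * C j - C j * C k)

lemma map_py_adapted {E : Fn n → Fn n} (hE : IsDer E)
    (hc : ∀ k F, Smooth F → py k (E F) = E (py k F)) {A : Fin n → Fn n}
    (hA : ∀ r, Smooth (A r)) (k : Fin n) {X : Matrix (Fin n) (Fin n) (Fn n)} (hX : SmoothMat X) :
    (X.map (adapted E A)).map (py k)
      = (X.map (py k)).map (adapted E A) - ∑ r, py k (A r) • X.map (py r) := by
  ext1 i j
  simp only [Matrix.map_apply, Matrix.sub_apply, Matrix.sum_apply, Matrix.smul_apply, smul_eq_mul]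
  exact py_adapted hE hc hA k (hX i j)

/-- The Jacobi identity for `E − Aʳ ∂/∂yʳ + B`, `∂/∂yʲ + Cⱼ` and `∂/∂yᵏ + Cₖ`. -/
lemma mixedCurv_jacobi {E : Fn n → Fn n} (hE : IsDer E)
    (hc : ∀ k F, Smooth F → py k (E F) = E (py k F)) {A : Fin n → Fn n}
    (hA : ∀ r, Smooth (A r)) {B : Matrix (Fin n) (Fin n) (Fn n)} (hB : SmoothMat B)
    {C : Fin n → Matrix (Fin n) (Fin n) (Fn n)} (hC : ∀ k, SmoothMat (C k)) (j k : Fin n) :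
    ((mixedCurv E A B C j).map (py k)
        + (C k * mixedCurv E A B C j - mixedCurv E A B C j * C k)
        + ∑ r, py j (A r) • vertCurv C k r)
      - ((mixedCurv E A B C k).map (py j)
        + (C j * mixedCurv E A B C k - mixedCurv E A B C k * C j)
        + ∑ r, py k (A r) • vertCurv C j r)
      = -((vertCurv C j k).map (adapted E A)
        + (B * vertCurv C j k - vertCurv C j k * B)) := by
  have hδ := isDer_adapted hE hA
  have hQ (j k : Fin n) : (mixedCurv E A B C j).map (py k) =
      (B.map (py j)).map (py k)
        - ((((C j).map (py k)).map (adapted E A)) - ∑ r, py k (A r) • (C j).map (py r))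
        - ((B.map (py k) * C j + B * (C j).map (py k))
          - ((C j).map (py k) * B + C j * B.map (py k)))
        + ∑ r, (py k (py j (A r)) • C r + py j (A r) • (C r).map (py k)) := by
    have hD := isDer_py k
    have hBC := hB.mul (hC j)
    have hCB := (hC j).mul hB
    have ha (r) : Smooth (py j (A r)) := (isDer_py j).smooth (hA r)
    have hs (r) := (hC r).smul (ha r)
    have h1 := (isDer_py j).smoothMat hB
    have h2 := hδ.smoothMat (hC j)
    rw [mixedCurv, hD.map_add ((h1.sub h2).sub (hBC.sub hCB)) (SmoothMat.sum hs),
      hD.map_sub (h1.sub h2) (hBC.sub hCB), hD.map_sub h1 h2, hD.map_sub hBC hCB,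
      hD.map_mul hB (hC j), hD.map_mul (hC j) hB, hD.map_sum hs,
      map_py_adapted hE hc hA k (hC j)]
    simp only [hD.map_smul (ha _) (hC _)]
  have hS : (vertCurv C j k).map (adapted E A) =
      ((C j).map (py k)).map (adapted E A) - ((C k).map (py j)).map (adapted E A)
        + (((C k).map (adapted E A) * C j + C k * (C j).map (adapted E A))
          - ((C j).map (adapted E A) * C k + C j * (C k).map (adapted E A))) := by
    have h1 := (isDer_py k).smoothMat (hC j)
    have h2 := (isDer_py j).smoothMat (hC k)
    have h3 := (hC k).mul (hC j)
    have h4 := (hC j).mul (hC k)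
    rw [vertCurv, hδ.map_add (h1.sub h2) (h3.sub h4), hδ.map_sub h1 h2, hδ.map_sub h3 h4,
      hδ.map_mul (hC k) (hC j), hδ.map_mul (hC j) (hC k)]
  have hBjk : (B.map (py j)).map (py k) = (B.map (py k)).map (py j) := by
    ext1 a b
    exact py_comm j k (hB a b)
  rw [hQ, hQ, hS, hBjk]
  simp only [py_comm j k (hA _), mixedCurv, vertCurv, sum_add_distrib, sum_sub_distrib, smul_add,
    smul_sub, mul_add, mul_sub, add_mul, sub_mul, mul_sum, sum_mul, mul_smul_comm, smul_mul_assoc,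
    mul_assoc]
  abel

/-- The matrices `Cₖ = (Cˡₚₖ)` of the vertical part of a connection. -/
def vertMat (Γ : Conn n) (k : Fin n) : Matrix (Fin n) (Fin n) (Fn n) := fun l p => Γ.C l p k

/-- The matrices `Lᵢ = (Lˡₚᵢ)` of the spatial part of a connection. -/
def horMat (Γ : Conn n) (i : Fin n) : Matrix (Fin n) (Fin n) (Fn n) := fun l p => Γ.L l p i

/-- The matrix `(Gˡₚ)` of the temporal part of a connection. -/
def timeMat (Γ : Conn n) : Matrix (Fin n) (Fin n) (Fn n) := fun l p => Γ.G l p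

lemma Sc_eq_vertCurv (Γ : Conn n) (l p j k : Fin n) :
    Sc Γ l p j k = vertCurv (vertMat Γ) j k l p := by
  simp only [Sc, vertCurv, vertMat, Matrix.add_apply, Matrix.sub_apply, Matrix.map_apply,
    Matrix.mul_apply, mul_comm (Γ.C l _ _)]
  ring

lemma Sc_swap_mul (Γ : Conn n) (l p j k : Fin n) (F : Fn n) :
    Sc Γ l p j k * F = -(Sc Γ l p k j * F) := by
  simp only [Sc]
  ring

lemma Pc1_eq_mixedCurv (M : Fin n → Fn n) (N : Fin n → Fin n → Fn n) (Γ : Conn n)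
    (l p k : Fin n) :
    Pc1 M N Γ l p k = mixedCurv pt M (timeMat Γ) (vertMat Γ) k l p := by
  simp [Pc1, covT, CT, sigC, Fin.sum_univ_three, Function.update_apply, mixedCurv, vertMat, timeMat,
    Matrix.sum_apply, Matrix.mul_apply, Pv1, dt, adapted, mul_add, mul_sub, sum_add_distrib,
    mul_comm, mul_left_comm]
  ring

lemma Pc_eq_mixedCurv (M : Fin n → Fn n) (N : Fin n → Fin n → Fn n) (Γ : Conn n)
    (l p i k : Fin n) :
    Pc M N Γ l p i k = mixedCurv (px i) (fun r => N r i) (horMat Γ i) (vertMat Γ) k l p := by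
  simp [Pc, covX, CT, sigC, Fin.sum_univ_three, Function.update_apply, mixedCurv, vertMat, horMat,
    Matrix.sum_apply, Matrix.mul_apply, Pvsp, dx, adapted, mul_sub, mul_comm]
  ring

/-- local Bianchi identities for an h-normal Γ-linear connection
of Cartan type. -/
theorem bianchi_identities_17_18
    (n : ℕ) (hn : 1 ≤ n)
    (h : ℝ → ℝ) (hh : ContDiff ℝ (⊤ : ℕ∞) h) (hhpos : ∀ t, 0 < h t)
    (M : Fin n → Fn n) (N : Fin n → Fin n → Fn n) (Γ : Conn n)
    (hκ : Γ.κ = chr h)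
    (hMs : ∀ i, Smooth (M i)) (hNs : ∀ i j, Smooth (N i j))
    (hGs : ∀ k i, Smooth (Γ.G k i)) (hLs : ∀ k i j, Smooth (Γ.L k i j))
    (hCs : ∀ k i j, Smooth (Γ.C k i j))
    (hLsym : ∀ k i j, Γ.L k i j = Γ.L k j i) (hCsym : ∀ k i j, Γ.C k i j = Γ.C k j i) :
    (∀ l p j k,
      ((covY Γ sigPc1 k (Pc1T M N Γ) ![l, p, j]
          + (∑ r, Pv1 M Γ r j * Sc Γ l p k r))
        - (covY Γ sigPc1 j (Pc1T M N Γ) ![l, p, k]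
          + (∑ r, Pv1 M Γ r k * Sc Γ l p j r)))
      = -covT M Γ 0 sigSc (ScT Γ) ![l, p, j, k])
    ∧ (∀ l p i j k,
      (((∑ r, Pc M N Γ l p r j * Γ.C r i k)
          - (∑ r, Sc Γ l p j r * Pvsp N Γ r i k)
          - covY Γ sigPc j (PcT M N Γ) ![l, p, i, k])
        - ((∑ r, Pc M N Γ l p r k * Γ.C r i j)
          - (∑ r, Sc Γ l p k r * Pvsp N Γ r i j)
          - covY Γ sigPc k (PcT M N Γ) ![l, p, i, j]))
      = -covX N Γ sigSc i (ScT Γ) ![l, p, j, k]) := by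
  have hC (k) : SmoothMat (vertMat Γ k) := fun a b => hCs a b k
  constructor
  · intro l p j k
    have key := congrFun (congrFun (mixedCurv_jacobi isDer_pt (fun k F hF => py_pt_comm k hF) hMs
      (B := timeMat Γ) (fun a b => hGs a b) hC j k) l) p
    simp only [Matrix.add_apply, Matrix.sub_apply, Matrix.neg_apply, Matrix.map_apply,
      Matrix.mul_apply, Matrix.sum_apply, Matrix.smul_apply, smul_eq_mul, ← Sc_eq_vertCurv,
      ← Pc1_eq_mixedCurv M N, vertMat, timeMat] at key
    simp only [covY, covT, sigPc1, sigSc, Pc1T, ScT, Fin.sum_univ_three, Fin.sum_univ_four,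
      Function.update_apply, Pv1]
    simp [Sc_swap_mul Γ l p _ k, hCsym _ k j, add_mul, sub_mul, mul_sub, sum_add_distrib]
    simp [mul_comm, adapted, dt] at key ⊢
    linear_combination key
  · intro l p i j k
    have key := congrFun (congrFun (mixedCurv_jacobi (isDer_px i)
      (fun k F hF => py_px_comm k i hF) (fun r => hNs r i)
      (B := horMat Γ i) (fun a b => hLs a b i) hC j k) l) p
    simp only [Matrix.add_apply, Matrix.sub_apply, Matrix.neg_apply, Matrix.map_apply,
      Matrix.mul_apply, Matrix.sum_apply, Matrix.smul_apply, smul_eq_mul, ← Sc_eq_vertCurv,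
      ← Pc_eq_mixedCurv M N, vertMat, horMat] at key
    simp only [covY, covX, sigPc, sigSc, PcT, ScT, Fin.sum_univ_four,
      Function.update_apply, Pvsp]
    simp [Sc_swap_mul Γ l p _ k, hCsym _ k j, mul_sub]
    simp [mul_comm, adapted, dx] at key ⊢
    linear_combination key

end Jet
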